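/- Truth Lemma 2: in the canonical model M, for every X ∈ Ξ, every w ∈ X, and every sentence A: M, X/h_w ⊨ A if and only if A ∈ w. -/

import Mathlib

set_option maxHeartbeats 1000000

/-! Syntax: countably many variables (indexed by ℕ), Booleans (⊥, →),
    modalities `S` (box), `[c]_a` (cstit) and `I_a` (imag) for agents in `Agent`. -/

inductive Form (Agent : Type) : Type
  | var : ℕ → Form Agent
  | fls : Form Agent
  | imp : Form Agent → Form Agent → Form Agent
  | box : Form Agent → Form Agent
  | cstit : Agent → Form Agent → Form Agent
  | imag : Agent → Form Agent → Form Agent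

namespace Form

variable {Agent : Type}

def neg (A : Form Agent) : Form Agent := A.imp .fls

def conj (A B : Form Agent) : Form Agent := (A.imp B.neg).neg

def fiff (A B : Form Agent) : Form Agent := (A.imp B).conj (B.imp A)

/-- `P`, the dual of `S`. -/
def pos (A : Form Agent) : Form Agent := A.neg.box.neg

/-- The dual of `[c]_a`. -/
def posC (a : Agent) (A : Form Agent) : Form Agent := (Form.cstit a A.neg).neg

def verum : Form Agent := (Form.fls : Form Agent).neg

end Form

def listConj {Agent : Type} : List (Form Agent) → Form Agent
  | [] => Form.verum
  | A :: l => A.conj (listConj l)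

/-- Propositional tautologies: true under every Boolean valuation treating
    variables and modalized formulas as atoms. -/
def Tautology {Agent : Type} (A : Form Agent) : Prop :=
  ∀ v : Form Agent → Prop, ¬ v .fls → (∀ B C : Form Agent, v (B.imp C) ↔ (v B → v C)) → v A

/-- The Hilbert system L: (A0) tautologies, (A1) S is S5, (A2) each [c]_a is S5,
    (A3) SA → [c]_aA, (A4) independence axiom, (A5) imagination-as-action axiom;
    rules: modus ponens, S-necessitation, replacement of equivalents under I_a. -/
inductive Prov {Agent : Type} : Form Agent → Prop
  | taut {A : Form Agent} : Tautology A → Prov A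
  | sK (A B : Form Agent) : Prov ((A.imp B).box.imp (A.box.imp B.box))
  | sT (A : Form Agent) : Prov (A.box.imp A)
  | s5 (A : Form Agent) : Prov (A.pos.imp A.pos.box)
  | cK (a : Agent) (A B : Form Agent) :
      Prov ((Form.cstit a (A.imp B)).imp ((Form.cstit a A).imp (Form.cstit a B)))
  | cT (a : Agent) (A : Form Agent) : Prov ((Form.cstit a A).imp A)
  | c5 (a : Agent) (A : Form Agent) :
      Prov ((Form.posC a A).imp (Form.cstit a (Form.posC a A)))
  | a3 (a : Agent) (A : Form Agent) : Prov (A.box.imp (Form.cstit a A))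
  | a4 (l : List (Agent × Form Agent)) (hne : l ≠ []) (hnd : (l.map Prod.fst).Nodup) :
      Prov ((listConj (l.map fun p => (Form.cstit p.1 p.2).pos)).imp
        (listConj (l.map fun p => Form.cstit p.1 p.2)).pos)
  | a5 (a : Agent) (A : Form Agent) :
      Prov ((Form.imag a A).imp ((Form.cstit a (Form.imag a A)).conj (Form.imag a A).box.neg))
  | mp {A B : Form Agent} : Prov (A.imp B) → Prov A → Prov B
  | necS {A : Form Agent} : Prov A → Prov A.box
  | reI (a : Agent) {A B : Form Agent} :
      Prov (A.fiff B) → Prov ((Form.imag a A).fiff (Form.imag a B))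

/-- A set is L-consistent iff no finite conjunction of its members derives a contradiction. -/
def Consistent {Agent : Type} (Γ : Set (Form Agent)) : Prop :=
  ¬ ∃ l : List (Form Agent), (∀ A ∈ l, A ∈ Γ) ∧ Prov ((listConj l).imp .fls)

/-- L-maxiconsistent: L-consistent and maximal among L-consistent sets. -/
def MaxConsistent {Agent : Type} (w : Set (Form Agent)) : Prop :=
  Consistent w ∧ ∀ Γ : Set (Form Agent), Consistent Γ → w ⊆ Γ → Γ = w

/-- Σ = {¬p : p ∈ Var} ∪ {SA ↔ A} ∪ {[c]_aA ↔ A}. -/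
def SigmaSet (Agent : Type) : Set (Form Agent) :=
  {φ | (∃ n : ℕ, φ = (Form.var n : Form Agent).neg) ∨
       (∃ A : Form Agent, φ = A.box.fiff A) ∨
       (∃ (a : Agent) (A : Form Agent), φ = (Form.cstit a A).fiff A)}

/-! Semantics: imagination models and satisfaction. -/

/-- The raw data of an imagination model (frame conditions separated out below). -/
structure PreModel (Agent : Type) where
  Tree : Type
  le : Tree → Tree → Prop
  Choice : Tree → Agent → Set (Set (Set Tree))
  N : Agent → Tree → Set Tree → Set (Set (Tree × Set Tree))
  V : ℕ → Set (Tree × Set Tree)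

namespace PreModel

variable {Agent : Type} (M : PreModel Agent)

/-- Histories are maximal chains. -/
def IsHist (h : Set M.Tree) : Prop := IsMaxChain M.le h

/-- The set of histories passing through `m`. -/
def Hm (m : M.Tree) : Set (Set M.Tree) := {h | M.IsHist h ∧ m ∈ h}

/-- `Choice^m_a(h)`: the histories lying in the same choice cell as `h` at `m`. -/
def Cell (m : M.Tree) (a : Agent) (h : Set M.Tree) : Set (Set M.Tree) :=
  {h' | ∃ e ∈ M.Choice m a, h ∈ e ∧ h' ∈ e}

/-- Satisfaction at a moment-history pair. -/
def Sat : Form Agent → M.Tree → Set M.Tree → Prop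
  | .var n, m, h => (m, h) ∈ M.V n
  | .fls, _, _ => False
  | .imp A B, m, h => Sat A m h → Sat B m h
  | .box A, m, h => ∀ h' ∈ M.Hm m, Sat A m h'
  | .cstit a A, m, h => ∀ h' ∈ M.Cell m a h, Sat A m h'
  | .imag a A, m, h =>
      (∀ h' ∈ M.Cell m a h,
        {p : M.Tree × Set M.Tree | M.IsHist p.2 ∧ p.1 ∈ p.2 ∧ Sat A p.1 p.2} ∈ M.N a m h') ∧
      (∃ h'' ∈ M.Hm m,
        {p : M.Tree × Set M.Tree | M.IsHist p.2 ∧ p.1 ∈ p.2 ∧ Sat A p.1 p.2} ∉ M.N a m h'')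

end PreModel

/-- An imagination model: the raw data together with all frame conditions. -/
structure IModel (Agent : Type) extends PreModel Agent where
  tree_nonempty : Nonempty Tree
  le_refl : ∀ x, le x x
  le_antisymm : ∀ x y, le x y → le y x → x = y
  le_trans : ∀ x y z, le x y → le y z → le x z
  lower_bound : ∀ m1 m2, ∃ m, le m m1 ∧ le m m2
  past_linear : ∀ m m1 m2, le m1 m → le m2 m → le m1 m2 ∨ le m2 m1
  choice_cells_nonempty : ∀ m a, ∀ e ∈ Choice m a, e.Nonempty
  choice_cover : ∀ m a, ⋃₀ (Choice m a) = toPreModel.Hm m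
  choice_disjoint : ∀ m a, ∀ e ∈ Choice m a, ∀ e' ∈ Choice m a, e ≠ e' → e ∩ e' = ∅
  no_choice_between_undivided : ∀ m a, ∀ e ∈ Choice m a, ∀ h h',
      h ∈ toPreModel.Hm m → h' ∈ toPreModel.Hm m → h ∈ e →
      (∃ m', (le m m' ∧ m ≠ m') ∧ m' ∈ h ∧ m' ∈ h') → h' ∈ e
  independence : ∀ m (f : Agent → Set (Set Tree)), (∀ a, f a ∈ Choice m a) →
      (⋂ a, f a).Nonempty

/-! The canonical model. -/

section Canonical

variable {Agent : Type}

/-- wRw' iff {A : SA ∈ w} ⊆ w'. -/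
def CanR (w w' : Set (Form Agent)) : Prop := ∀ A : Form Agent, A.box ∈ w → A ∈ w'

/-- w ≃_a w' iff {A : [c]_aA ∈ w} ⊆ w'. -/
def CanC (a : Agent) (w w' : Set (Form Agent)) : Prop :=
  ∀ A : Form Agent, Form.cstit a A ∈ w → A ∈ w'

/-- The R-class of a maxiconsistent set. -/
def RCls (w : Set (Form Agent)) : Set (Set (Form Agent)) :=
  {w' | MaxConsistent w' ∧ CanR w w'}

/-- Ξ: the set of R-equivalence classes. -/
def Xi (Agent : Type) : Set (Set (Set (Form Agent))) :=
  {X | ∃ w, MaxConsistent w ∧ X = RCls w}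

/-- E(X,a): the ≃_a-equivalence classes within X. -/
def ECls (X : Set (Set (Form Agent))) (a : Agent) : Set (Set (Set (Form Agent))) :=
  {e | ∃ w ∈ X, e = {w' ∈ X | CanC a w w'}}

/-- Raw canonical points: the fresh root `none`, classes `some (inl X)`, worlds `some (inr w)`. -/
def CPoint (Agent : Type) : Type := Option (Set (Set (Form Agent)) ⊕ Set (Form Agent))

/-- Tree = {0} ∪ Ξ ∪ W. -/
def CTreeSet (Agent : Type) : Set (CPoint Agent) :=
  {x | x = none ∨ (∃ X ∈ Xi Agent, x = some (Sum.inl X)) ∨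
       (∃ w, MaxConsistent w ∧ x = some (Sum.inr w))}

def CTree (Agent : Type) : Type := {x : CPoint Agent // x ∈ CTreeSet Agent}

/-- x ≤ y iff x = y or y ∈ x or x = 0. -/
def CLe (x y : CTree Agent) : Prop :=
  x = y ∨ (∃ X w, x.1 = some (Sum.inl X) ∧ y.1 = some (Sum.inr w) ∧ w ∈ X) ∨ x.1 = none

/-- h_w = {0, X, w}. -/
def CHistX (X : Set (Set (Form Agent))) (w : Set (Form Agent)) : Set (CTree Agent) :=
  {x | x.1 = none ∨ x.1 = some (Sum.inl X) ∨ x.1 = some (Sum.inr w)}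

def IsClsMoment (m : CTree Agent) : Prop := ∃ X, m.1 = some (Sum.inl X)

/-- The canonical choice function: vacuous outside Ξ, induced by E(X,a) at X ∈ Ξ. -/
def CChoice (m : CTree Agent) (a : Agent) : Set (Set (Set (CTree Agent))) :=
  {H | (¬ IsClsMoment m ∧ H = {h | IsMaxChain CLe h ∧ m ∈ h}) ∨
       (∃ X, m.1 = some (Sum.inl X) ∧ ∃ e ∈ ECls X a,
          H = {h | ∃ w ∈ e, h = CHistX X w})}

/-- Ext(A): {X/h_w : w ∈ X ∈ Ξ, A ∈ w}, augmented by all pairs m/h_w with m ∉ Ξ, m ∈ h_w,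
    in case A belongs to the maxiconsistent extension of Σ. -/
def CExt (A : Form Agent) : Set (CTree Agent × Set (CTree Agent)) :=
  {p | ∃ X w, X ∈ Xi Agent ∧ w ∈ X ∧ A ∈ w ∧
        p.1.1 = some (Sum.inl X) ∧ p.2 = CHistX X w} ∪
  {p | (∃ w0, MaxConsistent w0 ∧ SigmaSet Agent ⊆ w0 ∧ A ∈ w0) ∧
        ∃ X w, X ∈ Xi Agent ∧ w ∈ X ∧ p.2 = CHistX X w ∧
          ¬ IsClsMoment p.1 ∧ p.1 ∈ p.2}

/-- N_a(X/h_w) = {Ext A : I_aA ∈ w}; empty at moments outside Ξ. -/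
def CN (a : Agent) (m : CTree Agent) (h : Set (CTree Agent)) :
    Set (Set (CTree Agent × Set (CTree Agent))) :=
  {P | ∃ X w, m.1 = some (Sum.inl X) ∧ X ∈ Xi Agent ∧ w ∈ X ∧ h = CHistX X w ∧
        ∃ A, Form.imag a A ∈ w ∧ P = CExt A}

/-- V(p) = {X/h_w : w ∈ X ∈ Ξ, p ∈ w}. -/
def CV (Agent : Type) (n : ℕ) : Set (CTree Agent × Set (CTree Agent)) :=
  {p | ∃ X w, X ∈ Xi Agent ∧ w ∈ X ∧ Form.var n ∈ w ∧
        p.1.1 = some (Sum.inl X) ∧ p.2 = CHistX X w}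

/-- The canonical model (raw data). -/
def CanModel (Agent : Type) : PreModel Agent where
  Tree := CTree Agent
  le := CLe
  Choice := CChoice
  N := CN
  V := CV Agent

/-- The canonical moment corresponding to a class X ∈ Ξ. -/
def clsMoment {X : Set (Set (Form Agent))} (hX : X ∈ Xi Agent) : CTree Agent :=
  ⟨some (Sum.inl X), Or.inr (Or.inl ⟨X, hX, rfl⟩)⟩

end Canonical
section Helpers

variable {Agent : Type}

def IsVal (v : Form Agent → Prop) : Prop :=
  ¬ v .fls ∧ ∀ B C : Form Agent, v (B.imp C) ↔ (v B → v C)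

theorem IsVal.neg {v : Form Agent → Prop} (h : IsVal v) (A : Form Agent) :
    v A.neg ↔ ¬ v A := by
  unfold Form.neg; rw [h.2]; have := h.1; tauto

theorem IsVal.conj {v : Form Agent → Prop} (h : IsVal v) (A B : Form Agent) :
    v (A.conj B) ↔ (v A ∧ v B) := by
  unfold Form.conj; rw [h.neg, h.2, h.neg]; tauto

theorem IsVal.fiff {v : Form Agent → Prop} (h : IsVal v) (A B : Form Agent) :
    v (A.fiff B) ↔ (v A ↔ v B) := by
  unfold Form.fiff; rw [h.conj, h.2, h.2]; tauto

theorem IsVal.list {v : Form Agent → Prop} (h : IsVal v) (l : List (Form Agent)) :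
    v (listConj l) ↔ ∀ A ∈ l, v A := by
  induction l with
  | nil => simp [listConj, Form.verum, h.neg, h.1]
  | cons A l ih => simp [listConj, h.conj, ih]

theorem prov_taut {A : Form Agent} (H : ∀ v, IsVal v → v A) : Prov A :=
  Prov.taut fun v h0 h1 => H v ⟨h0, h1⟩

def Der (Γ : Set (Form Agent)) (A : Form Agent) : Prop :=
  ∃ l : List (Form Agent), (∀ B ∈ l, B ∈ Γ) ∧ Prov ((listConj l).imp A)

theorem Der.ofProv {Γ : Set (Form Agent)} {A : Form Agent} (h : Prov A) : Der Γ A := by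
  refine ⟨[], by simp, Prov.mp (prov_taut ?_) h⟩
  intro v hv
  rw [hv.2, hv.2]; tauto

theorem Der.mem {Γ : Set (Form Agent)} {A : Form Agent} (h : A ∈ Γ) : Der Γ A := by
  refine ⟨[A], by simpa using h, prov_taut ?_⟩
  intro v hv
  rw [hv.2, hv.list]; simp

theorem Der.mp {Γ : Set (Form Agent)} {A B : Form Agent} (h1 : Der Γ (A.imp B))
    (h2 : Der Γ A) : Der Γ B := by
  obtain ⟨l1, m1, p1⟩ := h1
  obtain ⟨l2, m2, p2⟩ := h2
  refine ⟨l1 ++ l2, ?_, Prov.mp (Prov.mp (prov_taut ?_) p1) p2⟩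
  · intro C hC
    rcases List.mem_append.1 hC with h | h
    · exact m1 C h
    · exact m2 C h
  · intro v hv
    simp only [hv.2, hv.list, List.mem_append]
    intro a b c
    exact a (fun A h => c A (Or.inl h)) (b (fun A h => c A (Or.inr h)))

open Classical in
theorem Der.deduct {Γ : Set (Form Agent)} {A B : Form Agent} (h : Der (insert A Γ) B) :
    Der Γ (A.imp B) := by
  obtain ⟨l, m, p⟩ := h
  refine ⟨l.filter (fun C => C ≠ A), ?_, Prov.mp (prov_taut ?_) p⟩
  · intro C hC
    simp at hC
    exact (m C hC.1).resolve_left hC.2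
  · intro v hv
    simp only [hv.2, hv.list]
    intro a b c
    apply a
    intro C hC
    by_cases e : C = A
    · exact e ▸ c
    · exact b C (by simp [hC, e])

theorem cons_iff {Γ : Set (Form Agent)} : Consistent Γ ↔ ¬ Der Γ .fls := Iff.rfl

theorem mcs_der {w : Set (Form Agent)} (hw : MaxConsistent w) {A : Form Agent} (h : Der w A) :
    A ∈ w := by
  have : Consistent (insert A w) := by
    intro h2
    exact hw.1 (Der.mp (Der.deduct h2) h)
  rw [← hw.2 _ this (Set.subset_insert _ _)]
  exact Set.mem_insert _ _

theorem mcs_prov {w : Set (Form Agent)} (hw : MaxConsistent w) {A : Form Agent} (h : Prov A) :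
    A ∈ w := mcs_der hw (Der.ofProv h)

theorem mcs_val {w : Set (Form Agent)} (hw : MaxConsistent w) : IsVal (fun A => A ∈ w) := by
  refine ⟨fun h => hw.1 (Der.mem h), fun B C => ⟨fun h1 h2 => ?_, fun h => ?_⟩⟩
  · exact mcs_der hw (Der.mp (Der.mem h1) (Der.mem h2))
  · by_cases hB : B ∈ w
    · apply mcs_der hw
      exact Der.mp (Der.ofProv (prov_taut fun v hv => by simp only [hv.2]; tauto)) (Der.mem (h hB))
    · have : ¬ Consistent (insert B w) := by
        intro hc
        apply hB
        rw [← hw.2 _ hc (Set.subset_insert _ _)]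
        exact Set.mem_insert _ _
      have hd : Der (insert B w) .fls := by
        by_contra hn; exact this hn
      refine mcs_der hw (Der.mp (Der.ofProv (prov_taut fun v hv => ?_)) hd.deduct)
      have := hv.1
      simp only [hv.2]; tauto

theorem mcs_imp {w : Set (Form Agent)} (hw : MaxConsistent w) {A B : Form Agent}
    (h : Prov (A.imp B)) (hA : A ∈ w) : B ∈ w :=
  ((mcs_val hw).2 A B).1 (mcs_prov hw h) hA

theorem mcs_neg {w : Set (Form Agent)} (hw : MaxConsistent w) {A : Form Agent} :
    A.neg ∈ w ↔ A ∉ w := (mcs_val hw).neg A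

theorem lindenbaum {Γ : Set (Form Agent)} (h : Consistent Γ) :
    ∃ w, MaxConsistent w ∧ Γ ⊆ w := by
  obtain ⟨w, hsub, hmax⟩ := zorn_subset_nonempty {Δ : Set (Form Agent) | Consistent Δ} (by
    intro c hc hch hne
    refine ⟨⋃₀ c, ?_, fun s hs => Set.subset_sUnion_of_mem hs⟩
    rintro ⟨l, hl, hp⟩
    have key : ∀ l : List (Form Agent), (∀ A ∈ l, A ∈ ⋃₀ c) → ∃ s ∈ c, ∀ A ∈ l, A ∈ s := by
      intro l
      induction l with
      | nil => intro _; obtain ⟨s, hs⟩ := hne; exact ⟨s, hs, by simp⟩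
      | cons A l ih =>
        intro hA
        obtain ⟨s, hs, hls⟩ := ih (fun B hB => hA B (List.mem_cons_of_mem _ hB))
        obtain ⟨t, ht, hAt⟩ := hA A List.mem_cons_self
        rcases hch.total hs ht with hst | hst
        · refine ⟨t, ht, ?_⟩
          intro B hB
          rcases List.mem_cons.1 hB with rfl | hB
          · exact hAt
          · exact hst (hls B hB)
        · refine ⟨s, hs, ?_⟩
          intro B hB
          rcases List.mem_cons.1 hB with rfl | hB
          · exact hst hAt
          · exact hls B hB
    obtain ⟨s, hs, hls⟩ := key l hl
    exact hc hs ⟨l, hls, hp⟩) Γ h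
  refine ⟨w, ⟨hmax.prop, fun Δ hΔ hw => ?_⟩, hsub⟩
  exact (hmax.eq_of_subset hΔ hw).symm

theorem prov_of_mcs {A : Form Agent} (h : ∀ w, MaxConsistent w → A ∈ w) : Prov A := by
  by_contra hn
  have : Consistent (insert A.neg (∅ : Set (Form Agent))) := by
    intro hd
    obtain ⟨l, hl, hp⟩ := Der.deduct hd
    have : l = [] := List.eq_nil_iff_forall_not_mem.2 (fun B hB => hl B hB)
    subst this
    apply hn
    refine Prov.mp (prov_taut fun v hv => ?_) hp
    have := hv.1
    simp only [hv.2, hv.list, hv.neg]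
    simp
    tauto
  obtain ⟨w, hw, hs⟩ := lindenbaum this
  exact (mcs_neg hw).1 (hs (Set.mem_insert _ _)) (h w hw)

/-- An S5 operator. -/
structure NBox (f : Form Agent → Form Agent) : Prop where
  K : ∀ A B, Prov ((f (A.imp B)).imp ((f A).imp (f B)))
  nec : ∀ A, Prov A → Prov (f A)
  T : ∀ A, Prov ((f A).imp A)
  five : ∀ A : Form Agent, Prov ((f A.neg).neg.imp (f (f A.neg).neg))

theorem nboxS : NBox (Form.box : Form Agent → Form Agent) :=
  ⟨Prov.sK, fun _ h => Prov.necS h, Prov.sT, Prov.s5⟩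

theorem nboxC (a : Agent) : NBox (Form.cstit a : Form Agent → Form Agent) :=
  ⟨Prov.cK a, fun A h => Prov.mp (Prov.a3 a A) (Prov.necS h), Prov.cT a, Prov.c5 a⟩

theorem NBox.mono {f : Form Agent → Form Agent} (hf : NBox f) {A B : Form Agent}
    (h : Prov (A.imp B)) : Prov ((f A).imp (f B)) :=
  Prov.mp (hf.K A B) (hf.nec _ h)

theorem NBox.exists {f : Form Agent → Form Agent} (hf : NBox f) {w : Set (Form Agent)}
    (hw : MaxConsistent w) {A : Form Agent} (h : f A ∉ w) :
    ∃ w', MaxConsistent w' ∧ (∀ B, f B ∈ w → B ∈ w') ∧ A ∉ w' := by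
  have key : ∀ l : List (Form Agent), (∀ B ∈ l, f B ∈ w) →
      ∀ A, Prov ((listConj l).imp A) → f A ∈ w := by
    intro l
    induction l with
    | nil =>
      intro _ A hp
      apply mcs_prov hw
      apply hf.nec
      refine Prov.mp (prov_taut fun v hv => ?_) hp
      simp only [hv.2, hv.list]; simp
    | cons B l ih =>
      intro hl A hp
      have h1 : f (B.imp A) ∈ w := by
        apply ih (fun C hC => hl C (List.mem_cons_of_mem _ hC))
        refine Prov.mp (prov_taut fun v hv => ?_) hp
        simp only [hv.2, hv.list, listConj, hv.conj]; tauto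
      exact ((mcs_val hw).2 _ _).1 (mcs_imp hw (hf.K B A) h1) (hl B List.mem_cons_self)
  have hc : Consistent (insert A.neg {B | f B ∈ w}) := by
    intro hd
    obtain ⟨l, hl, hp⟩ := Der.deduct hd
    apply h
    apply key l hl
    refine Prov.mp (prov_taut fun v hv => ?_) hp
    have := hv.1
    simp only [hv.2, hv.neg]; tauto
  obtain ⟨w', hw', hs⟩ := lindenbaum hc
  exact ⟨w', hw', fun B hB => hs (Set.mem_insert_of_mem _ hB),
    (mcs_neg hw').1 (hs (Set.mem_insert _ _))⟩

theorem NBox.euclid {f : Form Agent → Form Agent} (hf : NBox f) {u w w' : Set (Form Agent)}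
    (hu : MaxConsistent u) (hw : MaxConsistent w)
    (h1 : ∀ B, f B ∈ u → B ∈ w) (h2 : ∀ B, f B ∈ u → B ∈ w') (A : Form Agent) (hA : f A ∈ w) :
    A ∈ w' := by
  apply h2
  by_contra hn
  have dn : Prov (A.neg.neg.imp A) :=
    prov_taut fun v hv => by simp only [hv.2, hv.neg]; tauto
  have dn' : Prov (A.imp A.neg.neg) :=
    prov_taut fun v hv => by simp only [hv.2, hv.neg]; tauto
  have a1 : (f A.neg.neg).neg ∈ u := (mcs_neg hu).2 (fun h => hn (mcs_imp hu (hf.mono dn) h))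
  have a2 := h1 _ (mcs_imp hu (hf.five A.neg) a1)
  exact (mcs_neg hw).1 a2 (mcs_imp hw (hf.mono dn') hA)

/-- The collapsing valuation. -/
def Triv : Form Agent → Prop
  | .var _ => False
  | .fls => False
  | .imp A B => Triv A → Triv B
  | .box A => Triv A
  | .cstit _ A => Triv A
  | .imag _ _ => False

theorem triv_val : IsVal (Triv : Form Agent → Prop) := ⟨fun h => h, fun _ _ => Iff.rfl⟩

theorem triv_prov {A : Form Agent} (h : Prov A) : Triv A := by
  induction h with
  | taut h => exact h Triv triv_val.1 triv_val.2
  | sK A B => exact fun h => h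
  | sT A => exact fun h => h
  | s5 A => exact fun h => h
  | cK a A B => exact fun h => h
  | cT a A => exact fun h => h
  | c5 a A => exact fun h => h
  | a3 a A => exact fun h => h
  | a4 l _ _ =>
    rw [triv_val.2, triv_val.list]
    unfold Form.pos
    rw [triv_val.neg]
    simp only [Triv]
    rw [triv_val.neg, triv_val.list]
    intro h h2
    apply h2
    intro B hB
    obtain ⟨p, hp, rfl⟩ := List.mem_map.1 hB
    have := h _ (List.mem_map.2 ⟨p, hp, rfl⟩)
    rw [triv_val.neg] at this
    simp only [Triv, triv_val.neg] at this
    simpa only [Triv, not_not] using this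
  | a5 a A => exact fun h => h.elim
  | mp _ _ h1 h2 => exact h1 h2
  | necS _ h => exact h
  | reI a _ _ => rw [triv_val.fiff]; simp [Triv]

theorem val_mcs {v : Form Agent → Prop} (hv : IsVal v) (hp : ∀ A, Prov A → v A) :
    MaxConsistent {A | v A} := by
  constructor
  · rintro ⟨l, hl, h⟩
    exact hv.1 ((hv.2 _ _).1 (hp _ h) ((hv.list l).2 hl))
  · intro Γ hΓ hs
    refine Set.Subset.antisymm (fun A hA => ?_) hs
    by_contra hn
    have : A.neg ∈ Γ := hs ((hv.neg A).2 hn)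
    exact hΓ (Der.mp (Der.mem this) (Der.mem hA))

theorem triv_mcs : MaxConsistent {A : Form Agent | Triv A} := val_mcs triv_val fun _ => triv_prov

theorem sigma_triv : SigmaSet Agent ⊆ {A : Form Agent | Triv A} := by
  rintro φ (⟨n, rfl⟩ | ⟨A, rfl⟩ | ⟨a, A, rfl⟩)
  · exact fun h => h
  · exact (triv_val.fiff _ _).2 Iff.rfl
  · exact (triv_val.fiff _ _).2 Iff.rfl

theorem sigma_unique {w : Set (Form Agent)} (hw : MaxConsistent w) (hs : SigmaSet Agent ⊆ w)
    (A : Form Agent) : A ∈ w ↔ Triv A := by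
  have hb : ∀ A : Form Agent, A.box ∈ w ↔ A ∈ w := fun A =>
    ((mcs_val hw).fiff _ _).1 (hs (Or.inr (Or.inl ⟨A, rfl⟩)))
  have hcc : ∀ a, ∀ A : Form Agent, A.cstit a ∈ w ↔ A ∈ w := fun a A =>
    ((mcs_val hw).fiff _ _).1 (hs (Or.inr (Or.inr ⟨a, A, rfl⟩)))
  induction A with
  | var n =>
    have := (mcs_neg hw).1 (hs (Or.inl ⟨n, rfl⟩))
    simpa [Triv] using this
  | fls => simpa [Triv] using (mcs_val hw).1
  | imp A B ihA ihB => exact ((mcs_val hw).2 A B).trans (imp_congr ihA ihB)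
  | box A ih => exact (hb A).trans ih
  | cstit a A ih => exact (hcc a A).trans ih
  | imag a A ih =>
    simp only [Triv, iff_false]
    intro h
    have h2 := ((mcs_val hw).conj _ _).1 (mcs_imp hw (Prov.a5 a A) h)
    exact (mcs_neg hw).1 h2.2 ((hb _).2 h)

/-! classes -/

theorem xi_mcs {X : Set (Set (Form Agent))} (hX : X ∈ Xi Agent) {w} (hw : w ∈ X) :
    MaxConsistent w := by
  obtain ⟨u, hu, rfl⟩ := hX
  exact hw.1

theorem xi_eq {X : Set (Set (Form Agent))} (hX : X ∈ Xi Agent) {w} (hw : w ∈ X) :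
    X = RCls w := by
  obtain ⟨u, hu, rfl⟩ := hX
  have refl : CanR u u := fun A h => mcs_imp hu (Prov.sT A) h
  have sym : CanR w u := nboxS.euclid hu hw.1 hw.2 refl
  ext x
  constructor
  · intro hx
    exact ⟨hx.1, nboxS.euclid hu hw.1 hw.2 hx.2⟩
  · intro hx
    have : CanR w w := fun A h => mcs_imp hw.1 (Prov.sT A) h
    exact ⟨hx.1, nboxS.euclid hw.1 hu sym hx.2⟩

theorem mem_rcls {w : Set (Form Agent)} (hw : MaxConsistent w) : w ∈ RCls w :=
  ⟨hw, fun A h => mcs_imp hw (Prov.sT A) h⟩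

theorem rcls_xi {w : Set (Form Agent)} (hw : MaxConsistent w) : RCls w ∈ Xi Agent := ⟨w, hw, rfl⟩

theorem xi_nonempty {X : Set (Set (Form Agent))} (hX : X ∈ Xi Agent) : ∃ w, w ∈ X := by
  obtain ⟨u, hu, rfl⟩ := hX
  exact ⟨u, mem_rcls hu⟩

def wPt {w : Set (Form Agent)} (hw : MaxConsistent w) : CTree Agent :=
  ⟨some (Sum.inr w), Or.inr (Or.inr ⟨w, hw, rfl⟩)⟩

theorem ctree_cases (x : CTree Agent) : x.1 = none ∨
    (∃ X ∈ Xi Agent, x.1 = some (Sum.inl X)) ∨ (∃ w, MaxConsistent w ∧ x.1 = some (Sum.inr w)) :=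
  x.2

theorem cpt_inl {X Y : Set (Set (Form Agent))}
    (h : (some (Sum.inl X) : CPoint Agent) = some (Sum.inl Y)) : X = Y :=
  Sum.inl.inj (Option.some.inj h)

theorem cpt_inr {X Y : Set (Form Agent)}
    (h : (some (Sum.inr X) : CPoint Agent) = some (Sum.inr Y)) : X = Y :=
  Sum.inr.inj (Option.some.inj h)

theorem cpt_lr {X : Set (Set (Form Agent))} {Y : Set (Form Agent)}
    (h : (some (Sum.inl X) : CPoint Agent) = some (Sum.inr Y)) : False :=
  Sum.inl_ne_inr (Option.some.inj h)

theorem cpt_none {X : Set (Set (Form Agent)) ⊕ Set (Form Agent)}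
    (h : (some X : CPoint Agent) = none) : False :=
  Option.some_ne_none X h

theorem chain_sub_w {h : Set (CTree Agent)} (hc : IsChain CLe h) {w} (hw : MaxConsistent w)
    (hm : wPt hw ∈ h) : h ⊆ CHistX (RCls w) w := by
  intro x hx
  by_cases e : x = wPt hw
  · exact Or.inr (Or.inr (e ▸ rfl))
  rcases hc hx hm e with (h1 | ⟨Y, u, h1, h2, h3⟩ | h1) | (h1 | ⟨Y, u, h1, h2, h3⟩ | h1)
  · exact absurd h1 e
  · have hu := cpt_inr h2
    subst hu
    rcases ctree_cases x with h4 | ⟨Z, hZ, h4⟩ | ⟨z, hz, h4⟩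
    · exact (cpt_none (h1.symm.trans h4)).elim
    · have := cpt_inl (h1.symm.trans h4)
      subst this
      rw [xi_eq hZ h3] at h1
      exact Or.inr (Or.inl h1)
    · exact (cpt_lr (h1.symm.trans h4)).elim
  · exact Or.inl h1
  · exact absurd h1.symm e
  · exact (cpt_lr h1.symm).elim
  · exact (cpt_none h1).elim

theorem chain_sub {h : Set (CTree Agent)} (hc : IsChain CLe h) :
    ∃ X ∈ Xi Agent, ∃ w ∈ X, h ⊆ CHistX X w := by
  by_cases h1 : ∃ w, ∃ hw : MaxConsistent w, wPt hw ∈ h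
  · obtain ⟨w, hw, hm⟩ := h1
    exact ⟨_, rcls_xi hw, w, mem_rcls hw, chain_sub_w hc hw hm⟩
  have nw : ∀ x ∈ h, ∀ w, MaxConsistent w → x.1 = some (Sum.inr w) → False := by
    intro x hx w hw e
    have : x = wPt hw := Subtype.ext e
    exact h1 ⟨w, hw, this ▸ hx⟩
  by_cases h2 : ∃ X, ∃ hX : X ∈ Xi Agent, clsMoment hX ∈ h
  · obtain ⟨X, hX, hm⟩ := h2
    obtain ⟨w, hw⟩ := xi_nonempty hX
    refine ⟨X, hX, w, hw, ?_⟩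
    intro x hx
    rcases ctree_cases x with h4 | ⟨Z, hZ, h4⟩ | ⟨z, hz, h4⟩
    · exact Or.inl h4
    · by_cases e : x = clsMoment hX
      · exact Or.inr (Or.inl (e ▸ rfl))
      rcases hc hx hm e with (h1 | ⟨Y, u, h1, h2, h3⟩ | h1) | (h1 | ⟨Y, u, h1, h2, h3⟩ | h1)
      · exact absurd h1 e
      · exact (cpt_lr h2).elim
      · exact Or.inl h1
      · exact absurd h1.symm e
      · exact (cpt_lr (h4.symm.trans h2)).elim
      · exact (cpt_none h1).elim
    · exact (nw x hx z hz h4).elim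
  · refine ⟨_, rcls_xi triv_mcs, _, mem_rcls triv_mcs, ?_⟩
    intro x hx
    rcases ctree_cases x with h4 | ⟨Z, hZ, h4⟩ | ⟨z, hz, h4⟩
    · exact Or.inl h4
    · have : x = clsMoment hZ := Subtype.ext h4
      exact (h2 ⟨Z, hZ, this ▸ hx⟩).elim
    · exact (nw x hx z hz h4).elim

theorem hist_chain {X : Set (Set (Form Agent))} {w} (hw : w ∈ X) :
    IsChain CLe (CHistX X w) := by
  intro x hx y hy hne
  rcases hx with hx | hx | hx
  · exact Or.inl (Or.inr (Or.inr hx))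
  · rcases hy with hy | hy | hy
    · exact Or.inr (Or.inr (Or.inr hy))
    · exact (hne (Subtype.ext (hx.trans hy.symm))).elim
    · exact Or.inl (Or.inr (Or.inl ⟨X, w, hx, hy, hw⟩))
  · rcases hy with hy | hy | hy
    · exact Or.inr (Or.inr (Or.inr hy))
    · exact Or.inr (Or.inr (Or.inl ⟨X, w, hy, hx, hw⟩))
    · exact (hne (Subtype.ext (hx.trans hy.symm))).elim

theorem hist_max {X : Set (Set (Form Agent))} (hX : X ∈ Xi Agent) {w} (hw : w ∈ X) :
    IsMaxChain CLe (CHistX X w) := by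
  refine ⟨hist_chain hw, fun t ht hs => Set.Subset.antisymm hs ?_⟩
  have h1 : wPt (xi_mcs hX hw) ∈ t := hs (Or.inr (Or.inr rfl))
  have := chain_sub_w ht _ h1
  rwa [← xi_eq hX hw] at this

theorem max_hist {h : Set (CTree Agent)} (hh : IsMaxChain CLe h) :
    ∃ X ∈ Xi Agent, ∃ w ∈ X, h = CHistX X w := by
  obtain ⟨X, hX, w, hw, hs⟩ := chain_sub hh.1
  exact ⟨X, hX, w, hw, hh.2 (hist_chain hw) hs⟩

theorem hist_inj {X Y : Set (Set (Form Agent))} {w w'} (hw : MaxConsistent w)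
    (h : CHistX X w = CHistX Y w') : w = w' := by
  have : wPt hw ∈ CHistX Y w' := h ▸ Or.inr (Or.inr rfl)
  rcases this with h | h | h
  · exact (cpt_none h).elim
  · exact (cpt_lr h.symm).elim
  · exact cpt_inr h

theorem hist_cls {X Y : Set (Set (Form Agent))} {w} (hX : X ∈ Xi Agent)
    (h : clsMoment hX ∈ CHistX Y w) : X = Y := by
  rcases h with h | h | h
  · exact (cpt_none h).elim
  · exact cpt_inl h
  · exact (cpt_lr h).elim

theorem hm_cls {X : Set (Set (Form Agent))} (hX : X ∈ Xi Agent) (h : Set (CTree Agent)) :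
    h ∈ (CanModel Agent).Hm (clsMoment hX) ↔ ∃ w ∈ X, h = CHistX X w := by
  constructor
  · rintro ⟨h1, h2⟩
    obtain ⟨Y, hY, w, hw, rfl⟩ := max_hist h1
    have := hist_cls hX h2
    subst this
    exact ⟨w, hw, rfl⟩
  · rintro ⟨w, hw, rfl⟩
    exact ⟨hist_max hX hw, Or.inr (Or.inl rfl)⟩

theorem cell_cls {X : Set (Set (Form Agent))} (hX : X ∈ Xi Agent) (a : Agent) {w} (hw : w ∈ X)
    (h : Set (CTree Agent)) :
    h ∈ (CanModel Agent).Cell (clsMoment hX) a (CHistX X w) ↔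
      ∃ w' ∈ X, CanC a w w' ∧ h = CHistX X w' := by
  constructor
  · rintro ⟨H, (⟨h1, _⟩ | ⟨Y, h1, e, ⟨u, hu, rfl⟩, rfl⟩), h2, h3⟩
    · exact (h1 ⟨X, rfl⟩).elim
    · have := cpt_inl h1
      subst this
      obtain ⟨w1, ⟨hw1, hc1⟩, e1⟩ := h2
      obtain ⟨w2, ⟨hw2, hc2⟩, e2⟩ := h3
      have := hist_inj (xi_mcs hX hw) e1
      subst this
      exact ⟨w2, hw2, (nboxC a).euclid (xi_mcs hX hu) (xi_mcs hX hw) hc1 hc2, e2⟩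
  · rintro ⟨w', hw', hc, rfl⟩
    have hm := xi_mcs hX hw
    exact ⟨_, Or.inr ⟨X, rfl, _, ⟨w, hw, rfl⟩, rfl⟩,
      ⟨w, ⟨hw, fun A h => mcs_imp hm (Prov.cT a A) h⟩, rfl⟩, ⟨w', ⟨hw', hc⟩, rfl⟩⟩

theorem cell_non {m : CTree Agent} (hm : ¬ IsClsMoment m) (a : Agent) {h : Set (CTree Agent)}
    (hh : h ∈ (CanModel Agent).Hm m) :
    (CanModel Agent).Cell m a h = (CanModel Agent).Hm m := by
  ext h'
  constructor
  · rintro ⟨H, (⟨_, rfl⟩ | ⟨Y, h1, _⟩), h2, h3⟩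
    · exact h3
    · exact (hm ⟨Y, h1⟩).elim
  · intro h'h
    exact ⟨_, Or.inl ⟨hm, rfl⟩, hh, h'h⟩

theorem truth_non {m : CTree Agent} (hm : ¬ IsClsMoment m) (A : Form Agent) :
    ∀ h ∈ (CanModel Agent).Hm m, ((CanModel Agent).Sat A m h ↔ Triv A) := by
  induction A with
  | var n =>
    intro h hh
    simp only [PreModel.Sat, Triv, iff_false]
    rintro ⟨X, w, _, _, _, h1, _⟩
    exact hm ⟨X, h1⟩
  | fls => intro h hh; rfl
  | imp A B ihA ihB => intro h hh; simp only [PreModel.Sat, Triv, ihA h hh, ihB h hh]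
  | box A ih =>
    intro h hh
    simp only [PreModel.Sat, Triv]
    exact ⟨fun H => (ih h hh).1 (H h hh), fun H h' hh' => (ih h' hh').2 H⟩
  | cstit a A ih =>
    intro h hh
    simp only [PreModel.Sat, Triv, cell_non hm a hh]
    exact ⟨fun H => (ih h hh).1 (H h hh), fun H h' hh' => (ih h' hh').2 H⟩
  | imag a A ih =>
    intro h hh
    simp only [PreModel.Sat, Triv, cell_non hm a hh, iff_false]
    rintro ⟨h1, _⟩
    obtain ⟨X, w, h2, _⟩ := h1 h hh
    exact hm ⟨X, h2⟩

theorem ext_inj {A B : Form Agent} (h : CExt A = CExt B) : Prov (A.fiff B) := by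
  have key : ∀ A B : Form Agent, CExt A = CExt B → ∀ w, MaxConsistent w → A ∈ w → B ∈ w := by
    intro A B h w hw hA
    have : ((clsMoment (rcls_xi hw), CHistX (RCls w) w) : CTree Agent × Set (CTree Agent))
        ∈ CExt A := Or.inl ⟨_, w, rcls_xi hw, mem_rcls hw, hA, rfl, rfl⟩
    rw [h] at this
    rcases this with ⟨X, w', hX, hw', hB, _, h2⟩ | ⟨_, X, w', _, _, _, h2, _⟩
    · rw [hist_inj hw h2]; exact hB
    · exact (h2 ⟨_, rfl⟩).elim
  apply prov_of_mcs
  intro w hw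
  exact ((mcs_val hw).fiff _ _).2 ⟨key A B h w hw, key B A h.symm w hw⟩

theorem truth_set {A : Form Agent}
    (ih : ∀ X (hX : X ∈ Xi Agent), ∀ w ∈ X,
      ((CanModel Agent).Sat A (clsMoment hX) (CHistX X w) ↔ A ∈ w)) :
    {p : (CanModel Agent).Tree × Set (CanModel Agent).Tree |
      (CanModel Agent).IsHist p.2 ∧ p.1 ∈ p.2 ∧ (CanModel Agent).Sat A p.1 p.2} = CExt A := by
  ext ⟨m, h⟩
  constructor
  · rintro ⟨h1, h2, h3⟩
    dsimp only at h1 h2 h3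
    by_cases hm : IsClsMoment m
    · obtain ⟨Y, hY⟩ := hm
      rcases ctree_cases m with h4 | ⟨Z, hZ, h4⟩ | ⟨z, hz, h4⟩
      · exact (cpt_none (hY.symm.trans h4)).elim
      · have : m = clsMoment hZ := Subtype.ext h4
        subst this
        obtain ⟨w, hw, rfl⟩ := (hm_cls hZ h).1 ⟨h1, h2⟩
        exact Or.inl ⟨Z, w, hZ, hw, (ih Z hZ w hw).1 h3, rfl, rfl⟩
      · exact (cpt_lr (hY.symm.trans h4)).elim
    · obtain ⟨X, hX, w, hw, e⟩ := max_hist h1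
      exact Or.inr ⟨⟨_, triv_mcs, sigma_triv, (truth_non hm A h ⟨h1, h2⟩).1 h3⟩,
        X, w, hX, hw, e, hm, h2⟩
  · rintro (⟨X, w, hX, hw, hA, h1, h2⟩ | ⟨⟨w0, hw0, hs, hA⟩, X, w, hX, hw, e, hm, h2⟩)
    · dsimp only at h1 h2
      have : m = clsMoment hX := Subtype.ext h1
      subst this
      subst h2
      exact ⟨hist_max hX hw, Or.inr (Or.inl rfl), (ih X hX w hw).2 hA⟩
    · dsimp only at e hm h2
      have hh : IsMaxChain CLe h := e ▸ hist_max hX hw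
      exact ⟨hh, h2, (truth_non hm A h ⟨hh, h2⟩).2 ((sigma_unique hw0 hs A).1 hA)⟩

theorem ext_mem_N {X : Set (Set (Form Agent))} (hX : X ∈ Xi Agent) {w} (hw : w ∈ X) (a : Agent)
    (A : Form Agent) : CExt A ∈ CN a (clsMoment hX) (CHistX X w) ↔ A.imag a ∈ w := by
  constructor
  · rintro ⟨Y, w', h1, hY, hw', h2, B, hB, h3⟩
    have := hist_inj (xi_mcs hX hw) h2
    subst this
    have hm := xi_mcs hX hw
    exact (((mcs_val hm).fiff _ _).1 (mcs_prov hm (Prov.reI a (ext_inj h3)))).2 hB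
  · intro h
    exact ⟨X, w, rfl, hX, hw, rfl, A, h, rfl⟩

theorem truth_all (A : Form Agent) : ∀ X (hX : X ∈ Xi Agent), ∀ w ∈ X,
      ((CanModel Agent).Sat A (clsMoment hX) (CHistX X w) ↔ A ∈ w) := by
  induction A with
  | var n =>
    intro X hX w hw
    constructor
    · rintro ⟨Y, w', _, _, h, _, h2⟩
      rw [hist_inj (xi_mcs hX hw) h2]; exact h
    · intro h
      exact ⟨X, w, hX, hw, h, rfl, rfl⟩
  | fls =>
    intro X hX w hw
    exact ⟨fun h => h.elim, fun h => (mcs_val (xi_mcs hX hw)).1 h⟩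
  | imp A B ihA ihB =>
    intro X hX w hw
    exact (imp_congr (ihA X hX w hw) (ihB X hX w hw)).trans ((mcs_val (xi_mcs hX hw)).2 A B).symm
  | box A ih =>
    intro X hX w hw
    have hm := xi_mcs hX hw
    constructor
    · intro h
      by_contra hn
      obtain ⟨w', hw', hr, hA⟩ := nboxS.exists hm hn
      have hx : w' ∈ X := by rw [xi_eq hX hw]; exact ⟨hw', hr⟩
      exact hA ((ih X hX w' hx).1 (h _ ((hm_cls hX _).2 ⟨w', hx, rfl⟩)))
    · intro h h' hh'
      obtain ⟨w', hw', rfl⟩ := (hm_cls hX h').1 hh'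
      apply (ih X hX w' hw').2
      have h2 := hw'
      rw [xi_eq hX hw] at h2
      exact h2.2 A h
  | cstit a A ih =>
    intro X hX w hw
    have hm := xi_mcs hX hw
    constructor
    · intro h
      by_contra hn
      obtain ⟨w', hw', hr, hA⟩ := (nboxC a).exists hm hn
      have hx : w' ∈ X := by
        rw [xi_eq hX hw]
        exact ⟨hw', fun B hB => hr B (mcs_imp hm (Prov.a3 a B) hB)⟩
      exact hA ((ih X hX w' hx).1 (h _ ((cell_cls hX a hw _).2 ⟨w', hx, hr, rfl⟩)))
    · intro h h' hh'
      obtain ⟨w', hw', hc, rfl⟩ := (cell_cls hX a hw h').1 hh'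
      exact (ih X hX w' hw').2 (hc A h)
  | imag a A ih =>
    intro X hX w hw
    have hm := xi_mcs hX hw
    simp only [PreModel.Sat]
    rw [truth_set ih]
    constructor
    · rintro ⟨h, _⟩
      exact (ext_mem_N hX hw a A).1 (h _ ((cell_cls hX a hw _).2
        ⟨w, hw, fun A h => mcs_imp hm (Prov.cT a A) h, rfl⟩))
    · intro h
      have h5 := ((mcs_val hm).conj _ _).1 (mcs_imp hm (Prov.a5 a A) h)
      constructor
      · intro h' hh'
        obtain ⟨w', hw', hc, rfl⟩ := (cell_cls hX a hw h').1 hh'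
        exact (ext_mem_N hX hw' a A).2 (hc _ h5.1)
      · obtain ⟨w', hw', hr, hA⟩ := nboxS.exists hm ((mcs_neg hm).1 h5.2)
        have hx : w' ∈ X := by rw [xi_eq hX hw]; exact ⟨hw', hr⟩
        exact ⟨_, (hm_cls hX _).2 ⟨w', hx, rfl⟩, fun hN => hA ((ext_mem_N hX hx a A).1 hN)⟩

end Helpers

/-- Truth Lemma 2: for every X ∈ Ξ, w ∈ X and sentence A:
    M, X/h_w ⊨ A iff A ∈ w, in the canonical model M. -/
theorem truth_lemma_two (Agent : Type) [Fintype Agent] (X : Set (Set (Form Agent)))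
    (hX : X ∈ Xi Agent) (w : Set (Form Agent)) (hw : w ∈ X) (A : Form Agent) :
    (CanModel Agent).Sat A (clsMoment hX) (CHistX X w) ↔ A ∈ w := by
  exact truth_all A X hX w hw
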